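/- Let (C^n, δ_n, η_n) be a twisted complex over ℝ whose total untwisted cohomology ⊕_{n∈ℕ} H^n(C, δ) is finite-dimensional over ℝ. Then the twisted cohomology of the completion satisfies dim_ℝ H(Ĉ, δ + η) ≤ dim_ℝ (⊕_{n∈ℕ} H^n(C, δ)). (Abstract form of inequality (2.6) of the paper: for a manifold with finite-dimensional de Rham cohomology, dim H(M; η) ≤ dim H(M).) -/

import Mathlib

open DirectSum

/-- The twisted differential `D = δ + η` on the completion `Ĉ = ∏ n, C n`, as a linear
map. -/
def twistedDL (C : ℕ → Type) [∀ n, AddCommGroup (C n)] [∀ n, Module ℝ (C n)]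
    (δ : ∀ n, C n →ₗ[ℝ] C (n + 1)) (η : ∀ n, C n →ₗ[ℝ] C (n + 3)) :
    (∀ n, C n) →ₗ[ℝ] (∀ n, C n) where
  toFun c := fun n =>
    match n with
    | 0 => 0
    | 1 => δ 0 (c 0)
    | 2 => δ 1 (c 1)
    | (m + 3) => δ (m + 2) (c (m + 2)) + η m (c m)
  map_add' a b := by
    funext n
    match n with
    | 0 => simp
    | 1 => simp
    | 2 => simp
    | (m + 3) => simp; abel
  map_smul' r a := by
    funext n
    match n with
    | 0 => simp
    | 1 => simp
    | 2 => simp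
    | (m + 3) => simp

/-- The submodule of cocycles of `(C, δ)` in degree `n`. -/
abbrev untwistedZ (C : ℕ → Type) [∀ n, AddCommGroup (C n)] [∀ n, Module ℝ (C n)]
    (δ : ∀ n, C n →ₗ[ℝ] C (n + 1)) (n : ℕ) : Submodule ℝ (C n) :=
  LinearMap.ker (δ n)

/-- The submodule of coboundaries of `(C, δ)` in degree `n` (zero in degree `0`). -/
def untwistedB (C : ℕ → Type) [∀ n, AddCommGroup (C n)] [∀ n, Module ℝ (C n)]
    (δ : ∀ n, C n →ₗ[ℝ] C (n + 1)) : ∀ n, Submodule ℝ (C n)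
  | 0 => ⊥
  | (m + 1) => LinearMap.range (δ m)

/-- The untwisted cohomology `H^n(C, δ) = ker δ_n / im δ_{n-1}` (with `H^0 = ker δ_0`). -/
abbrev untwistedH (C : ℕ → Type) [∀ n, AddCommGroup (C n)] [∀ n, Module ℝ (C n)]
    (δ : ∀ n, C n →ₗ[ℝ] C (n + 1)) (n : ℕ) :=
  untwistedZ C δ n ⧸ (untwistedB C δ n).comap (untwistedZ C δ n).subtype

/-- The twisted cohomology `H(Ĉ, D) = ker D / im D` of the completion. -/
abbrev twistedH (C : ℕ → Type) [∀ n, AddCommGroup (C n)] [∀ n, Module ℝ (C n)]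
    (δ : ∀ n, C n →ₗ[ℝ] C (n + 1)) (η : ∀ n, C n →ₗ[ℝ] C (n + 3)) :=
  LinearMap.ker (twistedDL C δ η) ⧸
    (LinearMap.range (twistedDL C δ η)).comap (LinearMap.ker (twistedDL C δ η)).subtype

/-- If `f` sends the kernel of `g : M → U` into a subspace `S`, then the range of `f` exceeds
`S` in rank by at most the rank of `U`. -/
theorem rank_range_le_add_of_forall_mem.{u, v} {K : Type v} [DivisionRing K] {M V U : Type u}
    [AddCommGroup M] [Module K M] [AddCommGroup V] [Module K V] [AddCommGroup U] [Module K U]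
    (f : M →ₗ[K] V) (g : M →ₗ[K] U) (S : Submodule K V)
    (h : ∀ x, g x = 0 → f x ∈ S) :
    Module.rank K (LinearMap.range f) ≤ Module.rank K U + Module.rank K S := by
  obtain ⟨W, hW⟩ := (LinearMap.ker g).exists_isCompl
  have hle : LinearMap.range f ≤ W.map f ⊔ S := by
    rw [LinearMap.range_eq_map, ← hW.sup_eq_top, Submodule.map_sup, sup_comm]
    exact sup_le_sup_left (Submodule.map_le_iff_le_comap.2 h) _
  have hinj : Function.Injective (g.domRestrict W) := by
    rw [← LinearMap.ker_eq_bot, LinearMap.ker_domRestrict]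
    exact Submodule.disjoint_iff_comap_eq_bot.1 hW.symm.disjoint
  calc Module.rank K (LinearMap.range f)
      ≤ Module.rank K ↥(W.map f ⊔ S) := Submodule.rank_mono hle
    _ ≤ Module.rank K (W.map f) + Module.rank K S := Submodule.rank_add_le_rank_add_rank _ _
    _ ≤ Module.rank K U + Module.rank K S := by
      gcongr
      exact (rank_map_le f W).trans (LinearMap.rank_le_of_injective _ hinj)

/-- Over a division ring every linear map has a linear generalized inverse. -/
theorem LinearMap.exists_apply_apply_eq_of_mem_range {K V W : Type*} [DivisionRing K]
    [AddCommGroup V] [Module K V] [AddCommGroup W] [Module K W] (f : V →ₗ[K] W) :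
    ∃ s : W →ₗ[K] V, ∀ y ∈ LinearMap.range f, f (s y) = y := by
  obtain ⟨g, hg⟩ := f.rangeRestrict.exists_rightInverse_of_surjective f.range_rangeRestrict
  obtain ⟨s, hs⟩ := LinearMap.exists_extend g
  refine ⟨s, fun y hy => ?_⟩
  have h1 : s y = g ⟨y, hy⟩ := LinearMap.congr_fun hs ⟨y, hy⟩
  rw [h1]
  exact congrArg Subtype.val (LinearMap.congr_fun hg ⟨y, hy⟩)

/-- All but finitely many summands of a finite-dimensional direct sum over `ℕ` vanish. -/
theorem DirectSum.exists_forall_subsingleton_of_finiteDimensional {K : Type*} [DivisionRing K]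
    (M : ℕ → Type*) [∀ n, AddCommGroup (M n)] [∀ n, Module K (M n)]
    [FiniteDimensional K (⨁ n, M n)] : ∃ N, ∀ n, N ≤ n → Subsingleton (M n) := by
  classical
  obtain ⟨S, hS⟩ := Module.Finite.fg_top (R := K) (M := ⨁ n, M n)
  refine ⟨(S.sup fun x => x.support.sup id) + 1, fun n hn => ⟨fun a b => ?_⟩⟩
  have key : (⊤ : Submodule K (⨁ n, M n)) ≤ LinearMap.ker (DirectSum.component K ℕ M n) := by
    rw [← hS, Submodule.span_le]
    intro x hx
    by_contra hne
    have h1 : n ∈ x.support := DFinsupp.mem_support_iff.2 hne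
    have h2 : n ≤ x.support.sup id := Finset.le_sup (f := id) h1
    have h3 := Finset.le_sup (f := fun x : ⨁ n, M n => x.support.sup id) hx
    simp only at h3
    omega
  have h0 : ∀ a : M n, a = 0 := fun a => by
    have := key (Submodule.mem_top (x := DirectSum.lof K ℕ M n a))
    rwa [LinearMap.mem_ker, DirectSum.component.lof_self] at this
  rw [h0 a, h0 b]

section Twisted

variable {C : ℕ → Type} [∀ n, AddCommGroup (C n)] [∀ n, Module ℝ (C n)]
  {δ : ∀ n, C n →ₗ[ℝ] C (n + 1)} {η : ∀ n, C n →ₗ[ℝ] C (n + 3)}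

theorem twistedDL_twistedDL
    (hδδ : ∀ n (x : C n), δ (n + 1) (δ n x) = 0)
    (hδη : ∀ n (x : C n), δ (n + 3) (η n x) = - η (n + 1) (δ n x))
    (hηη : ∀ n (x : C n), η (n + 3) (η n x) = 0) (c : ∀ n, C n) :
    twistedDL C δ η (twistedDL C δ η c) = 0 := by
  funext n
  match n with
  | 0 => rfl
  | 1 => exact map_zero (δ 0)
  | 2 => exact hδδ 0 _
  | 3 =>
    change δ 2 (δ 1 (c 1)) + η 0 0 = 0
    rw [hδδ, map_zero, add_zero]
  | 4 =>
    change δ 3 (δ 2 (c 2) + η 0 (c 0)) + η 1 (δ 0 (c 0)) = 0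
    rw [map_add, hδδ, hδη, zero_add, neg_add_cancel]
  | 5 =>
    change δ 4 (δ 3 (c 3) + η 1 (c 1)) + η 2 (δ 1 (c 1)) = 0
    rw [map_add, hδδ, hδη, zero_add, neg_add_cancel]
  | m + 6 =>
    change δ (m + 5) (δ (m + 4) (c (m + 4)) + η (m + 2) (c (m + 2)))
      + η (m + 3) (δ (m + 2) (c (m + 2)) + η m (c m)) = 0
    rw [map_add, map_add, hδδ, hδη, hηη, zero_add, add_zero, neg_add_cancel]

theorem twistedDL_apply_succ_of_forall_lt {p : ℕ} {c : ∀ n, C n} (hc : ∀ m < p, c m = 0) :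
    twistedDL C δ η c (p + 1) = δ p (c p) := by
  match p with
  | 0 => rfl
  | 1 => rfl
  | m + 2 =>
    change δ (m + 2) (c (m + 2)) + η m (c m) = _
    rw [hc m (by omega), map_zero, add_zero]

theorem twistedDL_apply_of_forall_lt {p : ℕ} {c : ∀ n, C n} (hc : ∀ m < p, c m = 0)
    {m : ℕ} (hm : m ≤ p) : twistedDL C δ η c m = 0 := by
  match m with
  | 0 => rfl
  | m + 1 =>
    rw [twistedDL_apply_succ_of_forall_lt fun k hk => hc k (by omega), hc m (by omega), map_zero]

/-- The solution of `(δ + η) b = c` obtained by recursion on the degree, using degreewise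
candidates `s n` for inverses of `δ n`. -/
def twistedPrimitive (s : ∀ n, C (n + 1) →ₗ[ℝ] C n) (η : ∀ n, C n →ₗ[ℝ] C (n + 3))
    (c : ∀ n, C n) : ∀ n, C n
  | 0 => s 0 (c 1)
  | 1 => s 1 (c 2)
  | m + 2 => s (m + 2) (c (m + 3) - η m (twistedPrimitive s η c m))

theorem twistedPrimitive_eq_zero {s : ∀ n, C (n + 1) →ₗ[ℝ] C n} {c : ∀ n, C n} {N : ℕ}
    (hc : ∀ m ≤ N, c m = 0) (n : ℕ) (hn : n < N) : twistedPrimitive s η c n = 0 := by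
  match n with
  | 0 => rw [twistedPrimitive, hc 1 (by omega), map_zero]
  | 1 => rw [twistedPrimitive, hc 2 (by omega), map_zero]
  | m + 2 =>
    rw [twistedPrimitive, hc (m + 3) (by omega), twistedPrimitive_eq_zero hc m (by omega),
      map_zero, sub_zero, map_zero]

theorem exists_twistedDL_twistedPrimitive_apply_succ_eq
    (s : ∀ n, C (n + 1) →ₗ[ℝ] C n) (c : ∀ n, C n) (n : ℕ) :
    ∃ r, twistedDL C δ η (twistedPrimitive s η c) (n + 1) = δ n (s n r) + (c (n + 1) - r) := by
  match n with
  | 0 => exact ⟨c 1, by rw [sub_self, add_zero]; rfl⟩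
  | 1 => exact ⟨c 2, by rw [sub_self, add_zero]; rfl⟩
  | m + 2 =>
    exact ⟨c (m + 3) - η m (twistedPrimitive s η c m), by rw [sub_sub_cancel]; rfl⟩

/-- If `δ` is exact in degrees above `N`, then a twisted cocycle that vanishes up to degree `N`
is a twisted coboundary. -/
theorem mem_range_twistedDL_of_exact
    (hδδ : ∀ n (x : C n), δ (n + 1) (δ n x) = 0)
    (hδη : ∀ n (x : C n), δ (n + 3) (η n x) = - η (n + 1) (δ n x))
    (hηη : ∀ n (x : C n), η (n + 3) (η n x) = 0) {N : ℕ}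
    (hex : ∀ n, N ≤ n → LinearMap.ker (δ (n + 1)) ≤ LinearMap.range (δ n))
    {c : ∀ n, C n} (hDc : twistedDL C δ η c = 0) (hc : ∀ m ≤ N, c m = 0) :
    c ∈ LinearMap.range (twistedDL C δ η) := by
  choose s hs using fun n => (δ n).exists_apply_apply_eq_of_mem_range
  set b := twistedPrimitive s η c with hb
  have hDx : twistedDL C δ η (c - twistedDL C δ η b) = 0 := by
    rw [map_sub, hDc, twistedDL_twistedDL hδδ hδη hηη, sub_zero]
  refine ⟨b, (sub_eq_zero.1 (funext fun n => ?_)).symm⟩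
  induction n using Nat.strong_induction_on with
  | _ n ih =>
    obtain hn | hn := le_or_gt n N
    · rw [Pi.sub_apply, hc n hn,
        twistedDL_apply_of_forall_lt (twistedPrimitive_eq_zero hc) hn, sub_zero, Pi.zero_apply]
    · obtain ⟨k, rfl⟩ : ∃ k, n = k + 1 := ⟨n - 1, by omega⟩
      obtain ⟨r, hDb⟩ := exists_twistedDL_twistedPrimitive_apply_succ_eq (δ := δ) (η := η) s c k
      have hker : δ (k + 1) ((c - twistedDL C δ η b) (k + 1)) = 0 := by
        rw [← twistedDL_apply_succ_of_forall_lt (η := η) ih, hDx, Pi.zero_apply]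
      have hx : (c - twistedDL C δ η b) (k + 1) = r - δ k (s k r) := by
        rw [Pi.sub_apply, hb, hDb]; abel
      obtain ⟨y, hy⟩ := hex k (by omega) hker
      have hrange : r ∈ LinearMap.range (δ k) := ⟨y + s k r, by rw [map_add, hy, hx]; abel⟩
      rw [hx, hs k r hrange, sub_self, Pi.zero_apply]

/-- A twisted cochain whose lowest component, in degree `p`, is a `δ`-coboundary differs by a
twisted coboundary from one that starts in degree `p + 1`. -/
theorem exists_forall_sub_twistedDL_eq_zero {p : ℕ} {c : ∀ n, C n} (hc : ∀ m < p, c m = 0)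
    (hp : c p ∈ untwistedB C δ p) :
    ∃ b, ∀ m < p + 1, (c - twistedDL C δ η b) m = 0 := by
  match p with
  | 0 =>
    refine ⟨0, fun m hm => ?_⟩
    obtain rfl : m = 0 := by omega
    rw [map_zero, sub_zero]
    exact hp
  | q + 1 =>
    obtain ⟨y, hy⟩ := hp
    have hlow : ∀ m < q, (Pi.single q y : ∀ n, C n) m = 0 := fun m hm =>
      Pi.single_eq_of_ne (by omega) y
    refine ⟨Pi.single q y, fun m hm => ?_⟩
    obtain hm | rfl : m ≤ q ∨ m = q + 1 := by omega
    · rw [Pi.sub_apply, hc m (by omega), twistedDL_apply_of_forall_lt hlow hm, sub_zero]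
    · rw [Pi.sub_apply, twistedDL_apply_succ_of_forall_lt hlow, Pi.single_eq_same, hy, sub_self]

/-- The twisted cocycles that vanish in degrees below `p`. -/
def twistedZFiltration (δ : ∀ n, C n →ₗ[ℝ] C (n + 1)) (η : ∀ n, C n →ₗ[ℝ] C (n + 3)) (p : ℕ) :
    Submodule ℝ (LinearMap.ker (twistedDL C δ η)) :=
  (Submodule.pi (Set.Iio p) fun _ => ⊥).comap (LinearMap.ker (twistedDL C δ η)).subtype

theorem mem_twistedZFiltration {p : ℕ} {c : LinearMap.ker (twistedDL C δ η)} :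
    c ∈ twistedZFiltration δ η p ↔ ∀ m < p, c.1 m = 0 :=
  Iff.rfl

/-- The class in twisted cohomology of a twisted cocycle that vanishes in degrees below `p`. -/
def twistedFiltrationClass (δ : ∀ n, C n →ₗ[ℝ] C (n + 1)) (η : ∀ n, C n →ₗ[ℝ] C (n + 3))
    (p : ℕ) : twistedZFiltration δ η p →ₗ[ℝ] twistedH C δ η :=
  Submodule.mkQ _ ∘ₗ Submodule.subtype _

/-- The class in `H^p(C, δ)` of the component in degree `p` of a twisted cocycle that vanishes
in degrees below `p`. -/
def twistedLeadingClass (δ : ∀ n, C n →ₗ[ℝ] C (n + 1)) (η : ∀ n, C n →ₗ[ℝ] C (n + 3)) (p : ℕ) :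
    twistedZFiltration δ η p →ₗ[ℝ] untwistedH C δ p :=
  Submodule.mkQ _ ∘ₗ LinearMap.codRestrict (untwistedZ C δ p)
    (LinearMap.proj p ∘ₗ Submodule.subtype _ ∘ₗ Submodule.subtype _) fun c => by
      have h := twistedDL_apply_succ_of_forall_lt (δ := δ) (η := η) (mem_twistedZFiltration.1 c.2)
      rw [LinearMap.mem_ker.1 c.1.2] at h
      exact h.symm

theorem twistedFiltrationClass_mem_range_of_twistedLeadingClass_eq_zero
    (hδδ : ∀ n (x : C n), δ (n + 1) (δ n x) = 0)
    (hδη : ∀ n (x : C n), δ (n + 3) (η n x) = - η (n + 1) (δ n x))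
    (hηη : ∀ n (x : C n), η (n + 3) (η n x) = 0) {p : ℕ} (c : twistedZFiltration δ η p)
    (hc : twistedLeadingClass δ η p c = 0) :
    twistedFiltrationClass δ η p c ∈ LinearMap.range (twistedFiltrationClass δ η (p + 1)) := by
  have hp : c.1.1 p ∈ untwistedB C δ p := (Submodule.Quotient.mk_eq_zero
    ((untwistedB C δ p).comap (untwistedZ C δ p).subtype)).1 hc
  obtain ⟨b, hb⟩ := exists_forall_sub_twistedDL_eq_zero (η := η) (mem_twistedZFiltration.1 c.2) hp
  have hDb : twistedDL C δ η (twistedDL C δ η b) = 0 := twistedDL_twistedDL hδδ hδη hηη b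
  refine ⟨⟨c.1 - ⟨twistedDL C δ η b, hDb⟩, mem_twistedZFiltration.2 hb⟩,
    (Submodule.Quotient.eq _).2 ?_⟩
  change c.1 - _ - c.1 ∈ _
  rw [sub_sub_cancel_left]
  exact neg_mem ⟨b, rfl⟩

theorem rank_range_twistedFiltrationClass_le
    (hδδ : ∀ n (x : C n), δ (n + 1) (δ n x) = 0)
    (hδη : ∀ n (x : C n), δ (n + 3) (η n x) = - η (n + 1) (δ n x))
    (hηη : ∀ n (x : C n), η (n + 3) (η n x) = 0) (p : ℕ) :
    Module.rank ℝ (LinearMap.range (twistedFiltrationClass δ η p)) ≤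
      Module.rank ℝ (untwistedH C δ p) +
        Module.rank ℝ (LinearMap.range (twistedFiltrationClass δ η (p + 1))) := by
  refine rank_range_le_add_of_forall_mem (K := ℝ) (M := twistedZFiltration δ η p)
    (V := twistedH C δ η) (U := untwistedH C δ p) (twistedFiltrationClass δ η p)
    (twistedLeadingClass δ η p) (LinearMap.range (twistedFiltrationClass δ η (p + 1))) ?_
  intro c hc
  exact twistedFiltrationClass_mem_range_of_twistedLeadingClass_eq_zero hδδ hδη hηη c hc

end Twisted

/-- Abstract form of inequality (2.6) of the paper: if the total untwisted cohomology
`⊕ₙ H^n(C, δ)` of a twisted complex `(C, δ, η)` is finite-dimensional over `ℝ`, then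
`dim H(Ĉ, δ + η) ≤ dim ⊕ₙ H^n(C, δ)`. -/
theorem twisted_dimension_le
    (C : ℕ → Type) [∀ n, AddCommGroup (C n)] [∀ n, Module ℝ (C n)]
    (δ : ∀ n, C n →ₗ[ℝ] C (n + 1)) (η : ∀ n, C n →ₗ[ℝ] C (n + 3))
    (hδδ : ∀ n (x : C n), δ (n + 1) (δ n x) = 0)
    (hδη : ∀ n (x : C n), δ (n + 3) (η n x) = - η (n + 1) (δ n x))
    (hηη : ∀ n (x : C n), η (n + 3) (η n x) = 0)
    (hfin : FiniteDimensional ℝ (⨁ n : ℕ, untwistedH C δ n)) :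
    Module.rank ℝ (twistedH C δ η) ≤ Module.rank ℝ (⨁ n : ℕ, untwistedH C δ n) := by
  obtain ⟨N, hN⟩ := DirectSum.exists_forall_subsingleton_of_finiteDimensional (K := ℝ)
    fun n => untwistedH C δ n
  have hex : ∀ n, N ≤ n → LinearMap.ker (δ (n + 1)) ≤ LinearMap.range (δ n) := fun n hn x hx => by
    have := hN (n + 1) (by omega)
    exact (Submodule.Quotient.mk_eq_zero ((untwistedB C δ (n + 1)).comap
      (untwistedZ C δ (n + 1)).subtype) (x := ⟨x, hx⟩)).1 (Subsingleton.elim _ _)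
  have htop : LinearMap.range (twistedFiltrationClass δ η 0) = ⊤ := by
    refine LinearMap.range_eq_top.2 fun x => ?_
    obtain ⟨c, rfl⟩ := Submodule.mkQ_surjective _ x
    exact ⟨⟨c, mem_twistedZFiltration.2 fun m hm => absurd hm (Nat.not_lt_zero m)⟩, rfl⟩
  have hbot : LinearMap.range (twistedFiltrationClass δ η (N + 1)) = ⊥ := by
    refine eq_bot_iff.2 ?_
    rintro _ ⟨c, rfl⟩
    exact (Submodule.Quotient.mk_eq_zero _).2 (mem_range_twistedDL_of_exact hδδ hδη hηη hex c.1.2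
      fun m hm => mem_twistedZFiltration.1 c.2 m (Nat.lt_succ_of_le hm))
  have key : ∀ f : ℕ → Cardinal, (∀ n, Module.rank ℝ (untwistedH C δ n) = f n) → ∀ p ≤ N + 1,
      Module.rank ℝ (LinearMap.range (twistedFiltrationClass δ η p)) ≤
        Cardinal.sum fun i => f (i + p) := by
    intro f hf p hp
    induction hp using Nat.decreasingInduction with
    | self => rw [hbot, rank_bot]; exact zero_le
    | of_succ p _ ih =>
      rw [Cardinal.sum_nat_eq_add_sum_succ, Nat.zero_add, ← hf p]
      simp only [Nat.add_assoc, Nat.add_comm 1 p]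
      exact (rank_range_twistedFiltrationClass_le hδδ hδη hηη p).trans (add_le_add_right ih _)
  have h := key _ (fun _ => rfl) 0 (Nat.zero_le _)
  rw [htop, rank_top] at h
  have : ∀ n, Module.Free ℝ (untwistedH C δ n) := fun n => Module.Free.of_divisionRing ℝ _
  rw [rank_directSum]
  exact h
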